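/- Let T be a closed, densely defined semi-regular operator on a Banach space X (Rg(T) is closed and N(T) ⊆ Rg^∞(T)). Then the hyper-range Rg^∞(T) = ∩_{n≥1} Rg(T^n) is closed. -/

import Mathlib

open Filter Topology MeasureTheory Set

variable {X : Type*}

/-- Range of the `n`-th power of an unbounded operator `T` with domain `D`. -/
def unbRange [NormedAddCommGroup X] [NormedSpace ℂ X]
    (D : Submodule ℂ X) (T : D →ₗ[ℂ] X) : ℕ → Set X
  | 0 => Set.univ
  | n + 1 => {y : X | ∃ d : D, (d : X) ∈ unbRange D T n ∧ T d = y}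

theorem unbRange_sub [NormedAddCommGroup X] [NormedSpace ℂ X]
    (D : Submodule ℂ X) (T : D →ₗ[ℂ] X) (n : ℕ) :
    ∀ x y : X, x ∈ unbRange D T n → y ∈ unbRange D T n → x - y ∈ unbRange D T n := by
  induction n with
  | zero => intro x y _ _; trivial
  | succ n ih =>
    rintro x y ⟨d, hd, rfl⟩ ⟨e, he, rfl⟩
    exact ⟨d - e, ih _ _ hd he, map_sub T d e⟩

theorem exists_preimage_bound [NormedAddCommGroup X] [NormedSpace ℂ X] [CompleteSpace X]
    (D : Submodule ℂ X) (T : D →ₗ[ℂ] X)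
    (hgraph : IsClosed {p : X × X | ∃ d : D, (d : X) = p.1 ∧ T d = p.2})
    (hrange : IsClosed (LinearMap.range T : Set X)) :
    ∃ C : ℝ, ∀ d : D, ∃ e : D, T e = T d ∧ ‖(e : X)‖ ≤ C * ‖T d‖ := by
  let G : Submodule ℂ (X × X) := LinearMap.range (D.subtype.prod T)
  have hG : (G : Set (X × X)) = {p : X × X | ∃ d : D, (d : X) = p.1 ∧ T d = p.2} := by
    ext p
    simp [G, Prod.ext_iff]
  have hGc : IsClosed (G : Set (X × X)) := hG ▸ hgraph
  haveI : CompleteSpace G := hGc.completeSpace_coe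
  haveI : CompleteSpace (LinearMap.range T) := hrange.completeSpace_coe
  let f : G →L[ℂ] LinearMap.range T :=
    ((ContinuousLinearMap.snd ℂ X X).comp G.subtypeL).codRestrict (LinearMap.range T) (by
      rintro ⟨p, d, rfl⟩
      exact ⟨d, rfl⟩)
  have hf : Function.Surjective f := by
    rintro ⟨y, d, rfl⟩
    exact ⟨⟨(d, T d), d, rfl⟩, rfl⟩
  obtain ⟨C, _, hC⟩ := f.exists_preimage_norm_le hf
  refine ⟨C, fun d => ?_⟩
  obtain ⟨⟨p, e, rfl⟩, hp, hn⟩ := hC ⟨T d, d, rfl⟩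
  exact ⟨e, congrArg Subtype.val hp, le_trans (norm_fst_le ((e : X), T e)) hn⟩

/-- For a closed, densely defined semi-regular operator `T` (closed range, kernel contained
in every `Rg(T^n)`), the hyper-range `⋂_{n ≥ 1} Rg(T^n)` is closed. -/
theorem semiRegular_hyperRange_isClosed
    [NormedAddCommGroup X] [NormedSpace ℂ X] [CompleteSpace X]
    (D : Submodule ℂ X) (T : D →ₗ[ℂ] X)
    (hdense : Dense (D : Set X))
    (hgraph : IsClosed {p : X × X | ∃ d : D, (d : X) = p.1 ∧ T d = p.2})
    (hrange : IsClosed (LinearMap.range T : Set X))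
    (hker : ∀ n : ℕ, 1 ≤ n → ∀ d : D, T d = 0 → (d : X) ∈ unbRange D T n) :
    IsClosed (⋂ n ∈ {n : ℕ | 1 ≤ n}, unbRange D T n) := by
  obtain ⟨C, hC⟩ := exists_preimage_bound D T hgraph hrange
  have key : ∀ n : ℕ, IsClosed (unbRange D T n) := by
    intro n
    induction n with
    | zero => exact isClosed_univ
    | succ n ih =>
      have hk : ∀ d : D, T d = 0 → (d : X) ∈ unbRange D T n := by
        intro d hd
        rcases Nat.eq_zero_or_pos n with rfl | hn
        · trivial
        · exact hker n hn d hd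
      apply IsSeqClosed.isClosed
      intro y l hy hl
      choose d hd hdy using hy
      have hlr : l ∈ (LinearMap.range T : Set X) :=
        hrange.mem_of_tendsto hl (Eventually.of_forall fun k => ⟨d k, hdy k⟩)
      obtain ⟨b, rfl⟩ := hlr
      choose e he hen using fun k => hC (d k - b)
      have hlim : Tendsto (fun k => ((e k : D) : X)) atTop (𝓝 0) := by
        apply squeeze_zero_norm hen
        have h1 : Tendsto (fun k => y k - T b) atTop (𝓝 0) := by
          simpa using hl.sub_const (T b)
        simpa [hdy] using h1.norm.const_mul C
      refine ⟨b, ?_, rfl⟩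
      have h2 : Tendsto (fun k => (b : X) + (e k : X)) atTop (𝓝 (b : X)) := by
        simpa using hlim.const_add (b : X)
      refine ih.mem_of_tendsto h2 (Eventually.of_forall fun k => ?_)
      have h3 := unbRange_sub D T n _ _ (hd k) (hk (d k - b - e k) (by simp [he]))
      have h4 : (d k : X) - ((d k - b - e k : D) : X) = b + e k := by
        push_cast
        abel
      rwa [h4] at h3
  exact isClosed_biInter fun n _ => key n
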